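/- Let W be a simply-laced Weyl group, π a dominant integral weight with Stab_W(π) = W_P, and let v ≤ w be π-minuscule elements in W^P such that w v^{−1} is π′-minuscule for a dominant integral weight π′; let W_{P′} = Stab_W(π′). Then the map z ↦ z v^{−1} is an isomorphism from the Λ-Bruhat graph on [v,w]^P with constant admissible function Λ ≡ π to the Λ-Bruhat graph on [id, w v^{−1}]^{P′} with constant admissible function Λ′ ≡ π′: it is a poset isomorphism matching edges, and it satisfies W_{π′}(z v^{−1}) = W_π(z) for all z ∈ [v,w]^P (and all edge multiplicities equal 1 on both sides). -/

import Mathlib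

open scoped Classical BigOperators

/-- A bundled setting for a finite crystallographic root system together with its
Weyl group, its action on the rational span of the weight lattice, reflections,
and the data of coefficients of roots in the basis of simple roots. -/
structure WeylSetting where
  /-- index set of the Dynkin diagram (simple roots) -/
  I : Type
  [fintypeI : Fintype I]
  [decEqI : DecidableEq I]
  /-- rational span of the weight lattice -/
  V : Type
  [acg : AddCommGroup V]
  [mod : Module ℚ V]
  /-- the Weyl group -/
  W : Type
  [grp : Group W]
  /-- the action of the Weyl group on weights -/
  act : W →* (V ≃ₗ[ℚ] V)
  /-- the simple roots -/
  simple : I → V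
  /-- the (finite) set of roots -/
  roots : Finset V
  /-- `coroot β μ` is the pairing `⟨μ, β∨⟩` -/
  coroot : V → (V →ₗ[ℚ] ℚ)
  /-- the reflection `s_β ∈ W` associated to a root `β` -/
  srefl : V → W
  /-- coefficients of a positive root in the basis of simple roots -/
  posCoeff : V → I → ℕ
  simple_mem : ∀ i, simple i ∈ roots
  simple_indep : LinearIndependent ℚ simple
  roots_neg : ∀ β ∈ roots, -β ∈ roots
  root_pos_or_neg : ∀ β ∈ roots,
    (∃ c : I → ℚ, (∀ i, 0 ≤ c i) ∧ β = ∑ i, c i • simple i) ∨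
    (∃ c : I → ℚ, (∀ i, 0 ≤ c i) ∧ -β = ∑ i, c i • simple i)
  coroot_self : ∀ β ∈ roots, coroot β β = 2
  crystallographic : ∀ β ∈ roots, ∀ γ ∈ roots, ∃ n : ℤ, coroot β γ = n
  posCoeff_spec : ∀ β ∈ roots,
    (∃ c : I → ℚ, (∀ i, 0 ≤ c i) ∧ β = ∑ i, c i • simple i) →
    β = ∑ i, (posCoeff β i : ℚ) • simple i
  srefl_apply : ∀ β ∈ roots, ∀ v : V, act (srefl β) v = v - coroot β v • β
  act_faithful : ∀ g : W, (∀ v : V, act g v = v) → g = 1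
  roots_invariant : ∀ g : W, ∀ β ∈ roots, act g β ∈ roots
  coroot_equivariant : ∀ g : W, ∀ β ∈ roots, ∀ v : V,
    coroot (act g β) (act g v) = coroot β v
  generated : ∀ g : W, ∃ l : List I, g = (l.map fun i => srefl (simple i)).prod

namespace WeylSetting

attribute [instance] fintypeI decEqI acg mod grp

variable (D : WeylSetting)

/-- the simple reflection attached to a node of the Dynkin diagram -/
def s (i : D.I) : D.W := D.srefl (D.simple i)

/-- the product `s_{i_1} ⋯ s_{i_r}` of the simple reflections listed in `l` -/
def wordProd (l : List D.I) : D.W := (l.map D.s).prod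

/-- `β` is a positive root: a root which is a nonnegative combination of simple roots -/
def IsPosRoot (β : D.V) : Prop :=
  β ∈ D.roots ∧ ∃ c : D.I → ℚ, (∀ i, 0 ≤ c i) ∧ β = ∑ i, c i • D.simple i

/-- the length of a Weyl group element -/
noncomputable def length (g : D.W) : ℕ :=
  sInf {n | ∃ l : List D.I, l.length = n ∧ D.wordProd l = g}

/-- `l` is a reduced word for `g` -/
def IsReduced (l : List D.I) (g : D.W) : Prop :=
  D.wordProd l = g ∧ l.length = D.length g

/-- the number of reduced words of `g` -/
noncomputable def RedCard (g : D.W) : ℕ := Nat.card {l : List D.I // D.IsReduced l g}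

/-- the (strong) Bruhat order on the Weyl group -/
def bruhatLE : D.W → D.W → Prop :=
  Relation.ReflTransGen
    (fun a b => (∃ β, D.IsPosRoot β ∧ b = D.srefl β * a) ∧ D.length a < D.length b)

/-- strict (strong) Bruhat order -/
def bruhatLT (a b : D.W) : Prop := D.bruhatLE a b ∧ a ≠ b

/-- the left weak Bruhat order: `a ≤_L b` iff `ℓ(b a⁻¹) + ℓ(a) = ℓ(b)` -/
def weakLE (a b : D.W) : Prop := D.length (b * a⁻¹) + D.length a = D.length b

/-- the height of a positive root: the sum of its coefficients in the simple roots -/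
noncomputable def ht (β : D.V) : ℕ := ∑ i, D.posCoeff β i

/-- an integral weight: the pairings with all positive coroots are integers -/
def IsIntegral (lam : D.V) : Prop :=
  ∀ β, D.IsPosRoot β → ∃ n : ℤ, D.coroot β lam = n

/-- a dominant integral weight -/
def IsDominant (lam : D.V) : Prop :=
  D.IsIntegral lam ∧ ∀ i, 0 ≤ D.coroot (D.simple i) lam

/-- a pre-dominant integral weight: `⟨λ, β∨⟩ ≥ -1` for all positive roots `β` -/
def IsPreDominant (lam : D.V) : Prop :=
  D.IsIntegral lam ∧ ∀ β, D.IsPosRoot β → -1 ≤ D.coroot β lam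

/-- the diagram `D(λ) = {β ∈ R⁺ : ⟨λ, β∨⟩ = -1}` of a pre-dominant weight -/
noncomputable def diagram (lam : D.V) : Finset D.V :=
  D.roots.filter fun β => D.IsPosRoot β ∧ D.coroot β lam = -1

/-- `IsWeightPath λ [β₁, …, β_r]` says that
`λ = λ₀ →β₁ λ₁ →β₂ ⋯ →β_r λ_r` is a `λ`-path, i.e. each `β_j` is a positive
root, `⟨λ_{j-1}, β_j∨⟩ = -1` and `λ_j = s_{β_j}(λ_{j-1})`. -/
def IsWeightPath : D.V → List D.V → Prop
  | _, [] => True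
  | lam, β :: rest =>
      D.IsPosRoot β ∧ D.coroot β lam = -1 ∧
        IsWeightPath (D.act (D.srefl β) lam) rest

/-- the term `1/β₁ ⋅ 1/(β₁+β₂) ⋅ … ⋅ 1/(β₁+⋯+β_r)` attached to a path
`(β₁, …, β_r)`, computed in a field `F` via a linear embedding `emb`. -/
noncomputable def pathTerm {F : Type} [Field F] [Algebra ℚ F]
    (emb : D.V →ₗ[ℚ] F) (l : List D.V) : F :=
  ∏ j ∈ Finset.range l.length, (emb ((l.take (j + 1)).sum))⁻¹

/-- `w` is a π-minuscule element (in the sense of Peterson). -/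
def IsMinuscule (pi : D.V) (w : D.W) : Prop :=
  ∃ l : List D.I, D.IsReduced l w ∧
    ∀ k : Fin l.length,
      D.coroot (D.simple (l.get k)) (D.act (D.wordProd (l.drop (k.val + 1))) pi) = 1

/-- the stabilizer `W_π = Stab_W(π)` of a weight -/
def stab (pi : D.V) : Subgroup D.W where
  carrier := {g | D.act g pi = pi}
  one_mem' := by simp
  mul_mem' := by
    intro a b ha hb
    simp only [Set.mem_setOf_eq] at *
    calc D.act (a * b) pi = D.act a (D.act b pi) := by rw [map_mul]; rfl
    _ = pi := by rw [hb, ha]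
  inv_mem' := by
    intro a ha
    simp only [Set.mem_setOf_eq] at *
    calc D.act a⁻¹ pi = D.act a⁻¹ (D.act a pi) := by rw [ha]
    _ = D.act (a⁻¹ * a) pi := by rw [map_mul]; rfl
    _ = pi := by simp

/-- `u` is the minimal-length representative of its coset `uH` -/
def IsMinRep (H : Subgroup D.W) (u : D.W) : Prop :=
  ∀ g : D.W, u⁻¹ * g ∈ H → D.length u ≤ D.length g

/-- `a` and `b` lie in the same coset of `H`, i.e. `aH = bH` -/
def SameCoset (H : Subgroup D.W) (a b : D.W) : Prop := a⁻¹ * b ∈ H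

/-- `u →β w` in `W^P`: `β` is a positive root, `u, w` are minimal-length
representatives, `s_β w H = u H`, and `u < w` in Bruhat order -/
def Arrow (H : Subgroup D.W) (u w : D.W) (β : D.V) : Prop :=
  D.IsPosRoot β ∧ D.IsMinRep H u ∧ D.IsMinRep H w ∧
    D.SameCoset H (D.srefl β * w) u ∧ D.bruhatLT u w

/-- `ArrowPath H w [β₁, …, β_r]` encodes a directed path
`x_r →β_r ⋯ → x_1 →β₁ x_0 = w` in the Bruhat graph on `W^P`. -/
def ArrowPath (H : Subgroup D.W) : D.W → List D.V → Prop
  | _, [] => True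
  | w, β :: rest => ∃ u, D.Arrow H u w β ∧ ArrowPath H u rest

/-- directed paths as above whose vertices all lie above `v` in Bruhat order -/
def ArrowPathGE (H : Subgroup D.W) (v : D.W) : D.W → List D.V → Prop
  | _, [] => True
  | w, β :: rest => ∃ u, D.Arrow H u w β ∧ D.bruhatLE v u ∧ ArrowPathGE H v u rest

/-- directed paths from `u` to `w`:
`u = x_r →β_r ⋯ → x_1 →β₁ x_0 = w` encoded by the list `[β₁, …, β_r]`. -/
def ArrowPathFromTo (H : Subgroup D.W) (u : D.W) : D.W → List D.V → Prop
  | w, [] => u = w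
  | w, β :: rest => ∃ x, D.Arrow H x w β ∧ ArrowPathFromTo H u x rest

/-- `S(w) = {β ∈ R⁺ : s_β w < w}` -/
noncomputable def Sset (w : D.W) : Finset D.V :=
  D.roots.filter fun β => D.IsPosRoot β ∧ D.bruhatLT (D.srefl β * w) w

/-- `S(w/v) = {β ∈ R⁺ : v ≤ s_β w < w}` -/
noncomputable def SsetSkew (v w : D.W) : Finset D.V :=
  D.roots.filter fun β =>
    D.IsPosRoot β ∧ D.bruhatLE v (D.srefl β * w) ∧ D.bruhatLT (D.srefl β * w) w

/-- an oriented edge `x → y` in the Bruhat graph of `G/P`: `x, y` are minimal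
representatives, `xH < yH`, and `yH = x s_γ H` for some positive root `γ` -/
def GEdge (H : Subgroup D.W) (x y : D.W) : Prop :=
  D.IsMinRep H x ∧ D.IsMinRep H y ∧ D.bruhatLT x y ∧
    ∃ γ, D.IsPosRoot γ ∧ D.SameCoset H (x * D.srefl γ) y

/-- the (unique) positive root `γ` with `yH = x s_γ H` attached to an edge -/
noncomputable def edgeRoot (H : Subgroup D.W) (x y : D.W) : D.V :=
  if h : ∃ γ, D.IsPosRoot γ ∧ D.SameCoset H (x * D.srefl γ) y then h.choose else 0

/-- `GChainTo H v t [x₁, …, x_r]` encodes a directed path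
`v ≤ x_r → ⋯ → x_1 → x_0 = t` in the Bruhat graph of `G/P` -/
def GChainTo (H : Subgroup D.W) (v : D.W) : D.W → List D.W → Prop
  | _, [] => True
  | t, x :: rest => D.GEdge H x t ∧ D.bruhatLE v x ∧ GChainTo H v x rest

/-- the weighted term
`(m_Λ(x_r,x_{r-1})/W_Λ(x_r)) ⋯ (m_Λ(x_1,x_0)/W_Λ(x_1))` of a path in the
`Λ`-Bruhat graph, computed in a field `F` via a linear embedding `emb`. -/
noncomputable def chainTerm {F : Type} [Field F] [Algebra ℚ F]
    (emb : D.V →ₗ[ℚ] F) (H : Subgroup D.W) (Lam : D.W → D.V) (w : D.W) :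
    D.W → List D.W → F
  | _, [] => 1
  | t, x :: rest =>
      algebraMap ℚ F (D.coroot (D.edgeRoot H x t) (Lam x)) *
        (emb (D.act x (Lam x) - D.act w (Lam x)))⁻¹ *
        chainTerm emb H Lam w x rest

/-- the Bruhat order on cosets: `aH ≤ bH` -/
def cosetLE (H : Subgroup D.W) (a b : D.W) : Prop :=
  ∃ x y, D.SameCoset H a x ∧ D.SameCoset H b y ∧ D.bruhatLE x y

/-- the (standard) parabolic subgroup generated by simple reflections in `J` -/
def parab (J : Set D.I) : Subgroup D.W := Subgroup.closure (D.s '' J)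

/-- `X*(T)_P`: integral weights orthogonal to all coroots of `W_P`,
i.e. to `γ∨` for all positive roots `γ` in the span of the simple roots of `P` -/
def OrthWeightP (J : Set D.I) (lam : D.V) : Prop :=
  D.IsIntegral lam ∧
    ∀ γ, D.IsPosRoot γ → γ ∈ Submodule.span ℚ (D.simple '' J) → D.coroot γ lam = 0

/-- an admissible function `Λ : [v,w]^P → X*(T)_P` -/
def Admissible (J : Set D.I) (v w : D.W) (Lam : D.W → D.V) : Prop :=
  (∀ x, D.IsMinRep (D.parab J) x → D.bruhatLE v x → D.bruhatLE x w →
      D.OrthWeightP J (Lam x)) ∧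
  (∀ x, D.IsMinRep (D.parab J) x → D.bruhatLE v x → D.bruhatLE x w → x ≠ w →
      D.act x (Lam x) ≠ D.act w (Lam x))

/-- the subword of `l` with letters at the positions in `S`, in increasing order -/
def subwordF (l : List D.I) (S : Finset (Fin l.length)) : List D.I :=
  ((List.finRange l.length).filter fun j => j ∈ S).map l.get

/-- `β_j = s_{i_1} ⋯ s_{i_{j-1}}(α_{i_j})` attached to a reduced word `l` -/
noncomputable def refRoot (l : List D.I) (j : Fin l.length) : D.V :=
  D.act (D.wordProd (l.take j.val)) (D.simple (l.get j))

/-- the Weyl group is simply laced: the Cartan pairing is symmetric -/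
def SimplyLaced : Prop :=
  ∀ i j, D.coroot (D.simple i) (D.simple j) = D.coroot (D.simple j) (D.simple i)

/-- generating relation of the heap order of the word `l`:
`p_j < p_k` whenever `j < k` and `s_{i_j}`, `s_{i_k}` do not commute -/
def heapCovers (l : List D.I) (j k : Fin l.length) : Prop :=
  (j : ℕ) < (k : ℕ) ∧ D.s (l.get j) * D.s (l.get k) ≠ D.s (l.get k) * D.s (l.get j)

/-- the heap order of the word `l`: the minimal partial order generated by
`heapCovers` -/
def heapLE (l : List D.I) : Fin l.length → Fin l.length → Prop :=
  Relation.ReflTransGen (D.heapCovers l)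

/-- strict heap order -/
def heapLT (l : List D.I) (j k : Fin l.length) : Prop := D.heapLE l j k ∧ j ≠ k

/-- `F` is an order filter of the heap `H(w)` of the word `l` -/
def IsHeapFilter (l : List D.I) (F : Finset (Fin l.length)) : Prop :=
  ∀ j k, j ∈ F → D.heapLE l j k → k ∈ F

/-- `i` and `j` are joined by an edge of the Dynkin diagram -/
def adjDynkin (i j : D.I) : Prop := i ≠ j ∧ D.s i * D.s j ≠ D.s j * D.s i

/-- an elementary excitation `A ▷ B` of subsets of the heap of the word `l` -/
def Excite (l : List D.I) (A B : Finset (Fin l.length)) : Prop :=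
  ∃ p q, D.heapLT l p q ∧ l.get p = l.get q ∧ q ∈ A ∧ p ∈ B ∧
    A.erase q = B.erase p ∧
    (∀ z, D.heapLT l p z → D.heapLT l z q → l.get z ≠ l.get p) ∧
    ∀ u ∈ A, D.heapLE l p u → D.heapLE l u q → ¬ D.adjDynkin (l.get p) (l.get u)

/-- `A` is an excited diagram of `F` in the heap of the word `l`,
i.e. `A ∈ E_{H(w)}(F)` -/
def InExcited (l : List D.I) (F A : Finset (Fin l.length)) : Prop :=
  Relation.ReflTransGen (D.Excite l) F A

end WeylSetting
namespace WeylSetting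

section Proof

variable (D : WeylSetting)

lemma act_mul (a b : D.W) (x : D.V) : D.act (a * b) x = D.act a (D.act b x) := by
  rw [map_mul]; rfl

lemma act_inv_act (a : D.W) (x : D.V) : D.act a⁻¹ (D.act a x) = x := by
  rw [← act_mul]; simp

lemma act_act_inv (a : D.W) (x : D.V) : D.act a (D.act a⁻¹ x) = x := by
  rw [← act_mul]; simp

lemma ext_act {a b : D.W} (h : ∀ x, D.act a x = D.act b x) : a = b := by
  have : b⁻¹ * a = 1 := D.act_faithful _ fun x => by
    rw [act_mul, h, act_inv_act]
  exact (inv_mul_eq_one.mp this).symm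

lemma coroot_act {β : D.V} (hβ : β ∈ D.roots) (g : D.W) (x : D.V) :
    D.coroot β (D.act g x) = D.coroot (D.act g⁻¹ β) x := by
  have := D.coroot_equivariant g (D.act g⁻¹ β) (D.roots_invariant _ _ hβ) x
  rwa [act_act_inv] at this

/-- invariant form -/
noncomputable def B (x y : D.V) : ℚ := ∑ β ∈ D.roots, D.coroot β x * D.coroot β y

lemma B_act (g : D.W) (x y : D.V) : D.B (D.act g x) (D.act g y) = D.B x y := by
  unfold B
  refine Finset.sum_nbij' (fun β => D.act g⁻¹ β) (fun β => D.act g β) ?_ ?_ ?_ ?_ ?_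
  · intro β hβ; exact D.roots_invariant _ _ hβ
  · intro β hβ; exact D.roots_invariant _ _ hβ
  · intro β _; exact D.act_act_inv _ _
  · intro β _; exact D.act_inv_act _ _
  · intro β hβ
    simp only [D.coroot_act hβ]

lemma B_comm (x y : D.V) : D.B x y = D.B y x := by
  unfold B; exact Finset.sum_congr rfl fun _ _ => mul_comm _ _

lemma B_add_right (x y z : D.V) : D.B x (y + z) = D.B x y + D.B x z := by
  unfold B; rw [← Finset.sum_add_distrib]
  exact Finset.sum_congr rfl fun _ _ => by rw [map_add]; ring

lemma B_smul_right (x y : D.V) (c : ℚ) : D.B x (c • y) = c * D.B x y := by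
  unfold B; rw [Finset.mul_sum]
  exact Finset.sum_congr rfl fun _ _ => by rw [map_smul, smul_eq_mul]; ring

lemma B_sum_right (x : D.V) (c : D.I → ℚ) :
    D.B x (∑ i, c i • D.simple i) = ∑ i, c i * D.B x (D.simple i) := by
  unfold B
  simp_rw [map_sum, Finset.mul_sum, map_smul, smul_eq_mul]
  rw [Finset.sum_comm]
  exact Finset.sum_congr rfl fun _ _ => Finset.sum_congr rfl fun _ _ => by ring

lemma B_add_left (x y z : D.V) : D.B (x + y) z = D.B x z + D.B y z := by
  rw [B_comm, B_add_right, B_comm D z x, B_comm D z y]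

lemma B_smul_left (x y : D.V) (c : ℚ) : D.B (c • x) y = c * D.B x y := by
  rw [B_comm, B_smul_right, B_comm]

lemma B_pos {β : D.V} (hβ : β ∈ D.roots) : 0 < D.B β β := by
  unfold B
  have h1 : D.coroot β β * D.coroot β β ≤ ∑ γ ∈ D.roots, D.coroot γ β * D.coroot γ β :=
    Finset.single_le_sum (f := fun γ => D.coroot γ β * D.coroot γ β)
      (fun γ _ => mul_self_nonneg _) hβ
  rw [D.coroot_self β hβ] at h1
  linarith

lemma srefl_self {β : D.V} (hβ : β ∈ D.roots) : D.act (D.srefl β) β = -β := by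
  rw [D.srefl_apply β hβ, D.coroot_self β hβ, two_smul]; abel

lemma coroot_B {β : D.V} (hβ : β ∈ D.roots) (x : D.V) :
    D.coroot β x * D.B β β = 2 * D.B x β := by
  have h := D.B_act (D.srefl β) x β
  rw [srefl_self D hβ, D.srefl_apply β hβ] at h
  have e1 : x - D.coroot β x • β = x + (-D.coroot β x) • β := by rw [neg_smul]; abel
  have e2 : -β = (-1 : ℚ) • β := by simp
  rw [e1, e2, B_smul_right, B_add_left, B_smul_left] at h
  linarith

lemma coroot_smul {β γ : D.V} (hβ : β ∈ D.roots) (hγ : γ ∈ D.roots) {c : ℚ}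
    (h : β = c • γ) (x : D.V) : c * D.coroot β x = D.coroot γ x := by
  have hb := D.coroot_B hβ x
  have hg := D.coroot_B hγ x
  have p1 := D.B_pos hβ
  have p2 := D.B_pos hγ
  have hbb : D.B β β = c * (c * D.B γ γ) := by rw [h, B_smul_left, B_smul_right]
  have hxb : D.B x β = c * D.B x γ := by rw [h, B_smul_right]
  rw [hxb] at hb
  rw [hbb] at hb p1
  have hc : c ≠ 0 := by rintro rfl; simp at p1
  have : c * ((c * D.coroot β x - D.coroot γ x) * D.B γ γ) = 0 := by linear_combination hb - c * hg
  have h3 := (mul_eq_zero.mp this).resolve_left hc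
  have h4 := (mul_eq_zero.mp h3).resolve_right p2.ne'
  linarith

lemma coroot_neg {β : D.V} (hβ : β ∈ D.roots) (x : D.V) :
    D.coroot (-β) x = - D.coroot β x := by
  have := D.coroot_smul (D.roots_neg β hβ) hβ (c := -1) (by simp) x
  linarith

lemma srefl_smul {β γ : D.V} (hβ : β ∈ D.roots) (hγ : γ ∈ D.roots) {c : ℚ}
    (h : β = c • γ) : D.srefl β = D.srefl γ := by
  apply D.ext_act
  intro x
  rw [D.srefl_apply β hβ, D.srefl_apply γ hγ, ← D.coroot_smul hβ hγ h x, mul_comm, mul_smul, ← h]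

lemma srefl_neg {β : D.V} (hβ : β ∈ D.roots) : D.srefl (-β) = D.srefl β :=
  D.srefl_smul (D.roots_neg β hβ) hβ (c := -1) (by simp)

lemma srefl_conj {β : D.V} (hβ : β ∈ D.roots) (g : D.W) :
    D.srefl (D.act g β) = g * D.srefl β * g⁻¹ := by
  apply D.ext_act
  intro x
  rw [act_mul, act_mul, D.srefl_apply _ (D.roots_invariant _ _ hβ), D.srefl_apply β hβ,
    map_sub, map_smul, act_act_inv, coroot_act D hβ, inv_inv]

lemma srefl_mul_self {β : D.V} (hβ : β ∈ D.roots) : D.srefl β * D.srefl β = 1 := by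
  apply D.ext_act
  intro x
  rw [act_mul, D.srefl_apply β hβ x, map_sub, map_smul, srefl_self D hβ,
    D.srefl_apply β hβ x]
  simp

lemma srefl_inv {β : D.V} (hβ : β ∈ D.roots) : (D.srefl β)⁻¹ = D.srefl β :=
  inv_eq_of_mul_eq_one_left (D.srefl_mul_self hβ)

/-! coordinates -/

lemma exists_coord : ∃ e : D.V →ₗ[ℚ] (D.I →₀ ℚ), ∀ i, e (D.simple i) = Finsupp.single i 1 := by
  obtain ⟨g, hg⟩ := LinearMap.exists_leftInverse_of_injective
    (Finsupp.linearCombination ℚ D.simple) (LinearMap.ker_eq_bot.mpr D.simple_indep)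
  refine ⟨g, fun i => ?_⟩
  have := LinearMap.congr_fun hg (Finsupp.single i 1)
  simpa using this

noncomputable def crd (k : D.I) (x : D.V) : ℚ := (D.exists_coord.choose x) k

lemma crd_simple (k i : D.I) : D.crd k (D.simple i) = if i = k then 1 else 0 := by
  unfold crd; rw [D.exists_coord.choose_spec]; simp [Finsupp.single_apply]

lemma crd_add (k : D.I) (x y : D.V) : D.crd k (x + y) = D.crd k x + D.crd k y := by
  simp [crd]

lemma crd_sub (k : D.I) (x y : D.V) : D.crd k (x - y) = D.crd k x - D.crd k y := by
  simp [crd]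

lemma crd_neg (k : D.I) (x : D.V) : D.crd k (-x) = - D.crd k x := by
  simp [crd]

lemma crd_smul (k : D.I) (c : ℚ) (x : D.V) : D.crd k (c • x) = c * D.crd k x := by
  simp [crd]

lemma crd_sum (k : D.I) (c : D.I → ℚ) : D.crd k (∑ i, c i • D.simple i) = c k := by
  unfold crd; rw [map_sum, Finsupp.finsetSum_apply]
  simp_rw [map_smul, D.exists_coord.choose_spec]
  simp [Finsupp.single_apply]

lemma root_ne_zero {β : D.V} (hβ : β ∈ D.roots) : β ≠ 0 := by
  rintro rfl
  have := D.coroot_self 0 hβ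
  simp at this

lemma pos_crd {β : D.V} (h : D.IsPosRoot β) (k : D.I) : 0 ≤ D.crd k β := by
  obtain ⟨_, c, hc, rfl⟩ := h
  rw [crd_sum]; exact hc k

lemma pos_eq {β : D.V} (h : D.IsPosRoot β) : β = ∑ i, D.crd i β • D.simple i := by
  obtain ⟨_, c, hc, e⟩ := h
  have : ∀ i, D.crd i β = c i := fun i => by rw [e, crd_sum]
  simp_rw [this]; exact e

lemma pos_nat {β : D.V} (h : D.IsPosRoot β) (k : D.I) : ∃ n : ℕ, D.crd k β = n := by
  refine ⟨D.posCoeff β k, ?_⟩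
  conv_lhs => rw [D.posCoeff_spec β h.1 h.2]
  rw [crd_sum]

lemma pos_or_neg {β : D.V} (hβ : β ∈ D.roots) : D.IsPosRoot β ∨ D.IsPosRoot (-β) := by
  rcases D.root_pos_or_neg β hβ with h | h
  · exact Or.inl ⟨hβ, h⟩
  · exact Or.inr ⟨D.roots_neg β hβ, h⟩

lemma not_pos_neg {β : D.V} (h : D.IsPosRoot β) : ¬ D.IsPosRoot (-β) := by
  intro h'
  apply D.root_ne_zero h.1
  rw [D.pos_eq h]
  apply Finset.sum_eq_zero
  intro i _
  have h1 := D.pos_crd h i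
  have h2 := D.pos_crd h' i
  rw [crd_neg] at h2
  have : D.crd i β = 0 := by linarith
  simp [this]

lemma simple_pos (i : D.I) : D.IsPosRoot (D.simple i) := by
  refine ⟨D.simple_mem i, fun j => if j = i then 1 else 0, fun j => ?_, ?_⟩
  · dsimp only; split_ifs <;> norm_num
  · simp

/-- if a simple reflection makes a positive root non-positive, it is a multiple of the simple root -/
lemma simple_perm {β : D.V} (h : D.IsPosRoot β) (i : D.I)
    (h' : ¬ D.IsPosRoot (D.act (D.s i) β)) : ∃ c : ℚ, 0 < c ∧ β = c • D.simple i := by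
  have hr := D.roots_invariant (D.s i) β h.1
  have hn := (D.pos_or_neg hr).resolve_left h'
  have key : ∀ k, k ≠ i → D.crd k β = 0 := by
    intro k hk
    have h1 := D.pos_crd hn k
    rw [crd_neg] at h1
    unfold s at h1
    rw [D.srefl_apply _ (D.simple_mem i), crd_sub, crd_smul, crd_simple, if_neg (Ne.symm hk)] at h1
    have := D.pos_crd h k
    linarith
  have e : β = D.crd i β • D.simple i := by
    conv_lhs => rw [D.pos_eq h]
    apply Finset.sum_eq_single i
    · intro k _ hk; rw [key k hk, zero_smul]
    · simp
  refine ⟨D.crd i β, lt_of_le_of_ne (D.pos_crd h i) ?_, e⟩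
  intro h0
  rw [← h0, zero_smul] at e
  exact D.root_ne_zero h.1 e

/-! length -/

lemma wordProd_nil : D.wordProd [] = 1 := rfl

lemma wordProd_cons (i : D.I) (l : List D.I) : D.wordProd (i :: l) = D.s i * D.wordProd l := by
  simp [wordProd]

lemma wordProd_append (l m : List D.I) :
    D.wordProd (l ++ m) = D.wordProd l * D.wordProd m := by
  simp [wordProd]

lemma length_le (l : List D.I) : D.length (D.wordProd l) ≤ l.length :=
  Nat.sInf_le ⟨l, rfl, rfl⟩

lemma exists_reduced (g : D.W) : ∃ l, D.IsReduced l g := by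
  have hne : {n | ∃ l : List D.I, l.length = n ∧ D.wordProd l = g}.Nonempty := by
    obtain ⟨l, hl⟩ := D.generated g
    exact ⟨l.length, l, rfl, hl.symm⟩
  obtain ⟨l, h1, h2⟩ := Nat.sInf_mem hne
  exact ⟨l, h2, h1⟩

lemma length_mul_le (a b : D.W) : D.length (a * b) ≤ D.length a + D.length b := by
  obtain ⟨l, h1, h2⟩ := D.exists_reduced a
  obtain ⟨m, h3, h4⟩ := D.exists_reduced b
  rw [← h2, ← h4, ← h1, ← h3, ← wordProd_append, ← List.length_append]
  exact D.length_le _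

lemma length_s_le (i : D.I) : D.length (D.s i) ≤ 1 := by
  have := D.length_le [i]
  simpa [wordProd] using this

lemma length_one : D.length 1 = 0 := by
  have := D.length_le []
  simpa [wordProd] using this

lemma s_mul_self (i : D.I) : D.s i * D.s i = 1 := D.srefl_mul_self (D.simple_mem i)

lemma s_inv (i : D.I) : (D.s i)⁻¹ = D.s i := D.srefl_inv (D.simple_mem i)

lemma s_mul_s_mul (i : D.I) (a : D.W) : D.s i * (D.s i * a) = a := by
  rw [← mul_assoc, s_mul_self, one_mul]

/-- strong exchange -/
lemma exchange (l : List D.I) : ∀ β, D.IsPosRoot β →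
    ¬ D.IsPosRoot (D.act (D.wordProd l)⁻¹ β) →
    ∃ l' : List D.I, l'.length + 1 = l.length ∧ D.wordProd l' = D.srefl β * D.wordProd l := by
  induction l with
  | nil => intro β h h'; exact absurd (by simpa [wordProd] using h) h'
  | cons i l ih =>
    intro β h h'
    by_cases hp : D.IsPosRoot (D.act (D.s i) β)
    · have h2 : ¬ D.IsPosRoot (D.act (D.wordProd l)⁻¹ (D.act (D.s i) β)) := by
        rw [wordProd_cons, mul_inv_rev, s_inv, act_mul] at h'
        exact h'
      obtain ⟨l', h3, h4⟩ := ih _ hp h2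
      refine ⟨i :: l', by simp [h3], ?_⟩
      rw [wordProd_cons, h4, srefl_conj D h.1, wordProd_cons, s_inv]
      rw [mul_assoc, mul_assoc, s_mul_s_mul]
    · obtain ⟨c, _, hc⟩ := D.simple_perm h i hp
      refine ⟨l, rfl, ?_⟩
      rw [D.srefl_smul h.1 (D.simple_mem i) hc, wordProd_cons]
      exact (D.s_mul_s_mul i _).symm

lemma length_srefl_lt {β : D.V} (h : D.IsPosRoot β) (w : D.W)
    (h' : ¬ D.IsPosRoot (D.act w⁻¹ β)) : D.length (D.srefl β * w) < D.length w := by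
  obtain ⟨l, h1, h2⟩ := D.exists_reduced w
  rw [← h1] at h'
  obtain ⟨l', h3, h4⟩ := D.exchange l β h h'
  rw [h1] at h4
  have := D.length_le l'
  rw [h4] at this
  omega

lemma length_srefl_gt {β : D.V} (h : D.IsPosRoot β) (w : D.W)
    (h' : D.IsPosRoot (D.act w⁻¹ β)) : D.length w < D.length (D.srefl β * w) := by
  have := D.length_srefl_lt h (D.srefl β * w) (by
    rw [mul_inv_rev, act_mul, srefl_inv D h.1, srefl_self D h.1, map_neg]
    exact D.not_pos_neg h')
  rwa [← mul_assoc, srefl_mul_self D h.1, one_mul] at this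

/-! weights -/

lemma dom_nonneg {pi : D.V} (hpi : D.IsDominant pi) {β : D.V} (h : D.IsPosRoot β) :
    0 ≤ D.coroot β pi := by
  have h1 := D.coroot_B h.1 pi
  have h2 := D.B_pos h.1
  have h3 : 0 ≤ D.B pi β := by
    rw [D.pos_eq h, B_sum_right]
    apply Finset.sum_nonneg
    intro i _
    apply mul_nonneg (D.pos_crd h i)
    have h4 := D.coroot_B (D.simple_mem i) pi
    have h5 := D.B_pos (D.simple_mem i)
    have := mul_nonneg (hpi.2 i) h5.le
    linarith
  by_contra hneg
  push Not at hneg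
  nlinarith

lemma weight_int {pi : D.V} (hpi : D.IsDominant pi) {β : D.V} (h : β ∈ D.roots) (a : D.W) :
    ∃ n : ℤ, D.coroot β (D.act a pi) = n := by
  rw [coroot_act D h]
  have hr := D.roots_invariant a⁻¹ β h
  rcases D.pos_or_neg hr with hp | hp
  · exact hpi.1 _ hp
  · obtain ⟨n, hn⟩ := hpi.1 _ hp
    refine ⟨-n, ?_⟩
    rw [coroot_neg D hr] at hn
    push_cast; linarith

/-- minimal representative condition -/
def Cond (pi : D.V) (a : D.W) : Prop :=
  ∀ γ, D.IsPosRoot γ → D.coroot γ pi = 0 → D.IsPosRoot (D.act a γ)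

lemma cond_of_minRep {pi : D.V} {a : D.W} (h : D.IsMinRep (D.stab pi) a) : D.Cond pi a := by
  intro γ hγ h0
  by_contra hn
  have hr := D.roots_invariant a γ hγ.1
  have hp := (D.pos_or_neg hr).resolve_left hn
  have h1 := D.length_srefl_lt hp a (by
    rw [map_neg, act_inv_act]; exact D.not_pos_neg hγ)
  rw [srefl_neg D hr, srefl_conj D hγ.1, inv_mul_cancel_right] at h1
  have h2 := h (a * D.srefl γ) (by
    rw [inv_mul_cancel_left]
    show D.act (D.srefl γ) pi = pi
    rw [D.srefl_apply γ hγ.1, h0]; simp)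
  omega

lemma exists_neg {g : D.W} (hg : g ≠ 1) : ∃ i, ¬ D.IsPosRoot (D.act g (D.simple i)) := by
  obtain ⟨l, h1, h2⟩ := D.exists_reduced g⁻¹
  cases l with
  | nil => exact absurd (by simpa [wordProd] using h1.symm) hg
  | cons i l =>
    refine ⟨i, fun hp => ?_⟩
    have h3 := D.length_srefl_gt (D.simple_pos i) g⁻¹ (by rwa [inv_inv])
    have h4 : D.srefl (D.simple i) * g⁻¹ = D.wordProd l := by
      rw [← h1, wordProd_cons]; exact D.s_mul_s_mul i _
    rw [h4] at h3
    have := D.length_le l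
    simp at h2
    omega

lemma cond_unique {pi : D.V} (hpi : D.IsDominant pi) {a b : D.W} (ha : D.Cond pi a)
    (hb : D.Cond pi b) (h : D.act a pi = D.act b pi) : a = b := by
  by_contra hne
  have hg : b⁻¹ * a ≠ 1 := fun h1 => hne (inv_mul_eq_one.mp h1).symm
  obtain ⟨i, hi⟩ := D.exists_neg hg
  have hr := D.roots_invariant (b⁻¹ * a) _ (D.simple_mem i)
  have hp := (D.pos_or_neg hr).resolve_left hi
  have hfix : D.act (b⁻¹ * a) pi = pi := by rw [act_mul, h, act_inv_act]
  have e := D.coroot_equivariant (b⁻¹ * a) _ (D.simple_mem i) pi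
  rw [hfix] at e
  have h1 := D.dom_nonneg hpi hp
  rw [coroot_neg D hr, e] at h1
  have h2 := hpi.2 i
  have h0 : D.coroot (D.simple i) pi = 0 := by linarith
  have hA := ha _ (D.simple_pos i) h0
  have hB := hb _ hp (by rw [coroot_neg D hr, e, h0, neg_zero])
  rw [map_neg, act_mul, act_act_inv] at hB
  exact D.not_pos_neg hA hB

lemma minRep_of_cond {pi : D.V} (hpi : D.IsDominant pi) {a : D.W} (ha : D.Cond pi a) :
    D.IsMinRep (D.stab pi) a := by
  have hex : ∃ n, ∃ g, D.act g pi = D.act a pi ∧ D.length g = n := ⟨_, a, rfl, rfl⟩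
  obtain ⟨g0, h1, h2⟩ := Nat.find_spec hex
  have hmin : ∀ g, D.act g pi = D.act a pi → D.length g0 ≤ D.length g := by
    intro g hg
    rw [h2]; exact Nat.find_min' hex ⟨g, hg, rfl⟩
  have key : ∀ x g : D.W, x⁻¹ * g ∈ D.stab pi → D.act g pi = D.act x pi := by
    intro x g hg
    have : D.act (x⁻¹ * g) pi = pi := hg
    rw [act_mul] at this
    rw [← D.act_act_inv x (D.act g pi), this]
  have hm0 : D.IsMinRep (D.stab pi) g0 := fun g hg => hmin g ((key _ _ hg).trans h1)
  have := D.cond_unique hpi (D.cond_of_minRep hm0) ha h1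
  rwa [this] at hm0

lemma act_eq_of_sameCoset {pi : D.V} {x g : D.W} (hg : D.SameCoset (D.stab pi) x g) :
    D.act x pi = D.act g pi := by
  have : D.act (x⁻¹ * g) pi = pi := hg
  rw [act_mul] at this
  rw [← D.act_act_inv x (D.act g pi), this]

lemma sameCoset_of_act_eq {pi : D.V} {x g : D.W} (hg : D.act x pi = D.act g pi) :
    D.SameCoset (D.stab pi) x g := by
  show D.act (x⁻¹ * g) pi = pi
  rw [act_mul, ← hg, act_inv_act]

/-- minimal and predominant -/
def Good (pi : D.V) (a : D.W) : Prop :=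
  D.Cond pi a ∧ ∀ β, D.IsPosRoot β → -1 ≤ D.coroot β (D.act a pi)

lemma cond_s {pi : D.V} {a : D.W} (i : D.I) (ha : D.Cond pi a)
    (h : D.coroot (D.simple i) (D.act a pi) ≠ 0) : D.Cond pi (D.s i * a) := by
  intro γ hγ h0
  have hp := ha γ hγ h0
  by_contra hn
  rw [act_mul] at hn
  obtain ⟨c, hc, e⟩ := D.simple_perm hp i hn
  have h1 := D.coroot_smul hp.1 (D.simple_mem i) e (D.act a pi)
  rw [D.coroot_equivariant a γ hγ.1, h0] at h1
  apply h; linarith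

lemma coroot_s {β : D.V} (hβ : β ∈ D.roots) (i : D.I) (a : D.W) (pi : D.V) :
    D.coroot β (D.act (D.s i * a) pi) = D.coroot (D.act (D.s i) β) (D.act a pi) := by
  rw [act_mul, coroot_act D hβ, s_inv]

lemma s_simple (i : D.I) : D.act (D.s i) (D.simple i) = - D.simple i :=
  D.srefl_self (D.simple_mem i)

lemma good_s {pi : D.V} {a : D.W} (i : D.I) (ha : D.Good pi a)
    (h : D.coroot (D.simple i) (D.act a pi) = 1 ∨ D.coroot (D.simple i) (D.act a pi) = -1) :
    D.Good pi (D.s i * a) := by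
  refine ⟨D.cond_s i ha.1 (by rcases h with h | h <;> rw [h] <;> norm_num), ?_⟩
  intro β hβ
  by_cases hp : D.IsPosRoot (D.act (D.s i) β)
  · rw [coroot_s D hβ.1]; exact ha.2 _ hp
  · obtain ⟨c, hc, e⟩ := D.simple_perm hβ i hp
    have h1 := D.coroot_smul hβ.1 (D.simple_mem i) e (D.act (D.s i * a) pi)
    rw [coroot_s D (D.simple_mem i), s_simple, coroot_neg D (D.simple_mem i)] at h1
    obtain ⟨n, hn⟩ := D.pos_nat hβ i
    rw [e, crd_smul, crd_simple, if_pos rfl, mul_one] at hn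
    have hc1 : (1 : ℚ) ≤ c := by
      rw [hn] at hc ⊢
      have : 0 < n := by exact_mod_cast hc
      exact_mod_cast this
    by_contra hlt
    push Not at hlt
    rcases h with h | h <;> rw [h] at h1 <;> nlinarith

lemma good_of_minuscule {pi : D.V} (hpi : D.IsDominant pi) {w : D.W}
    (hw : D.IsMinuscule pi w) : D.Good pi w := by
  obtain ⟨l, ⟨hl, hlen⟩, h⟩ := hw
  clear hlen
  subst hl
  induction l with
  | nil =>
    rw [wordProd_nil]
    refine ⟨fun γ hγ _ => by simpa using hγ, fun β hβ => ?_⟩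
    have := D.dom_nonneg hpi hβ
    simp; linarith
  | cons i l ih =>
    rw [wordProd_cons]
    apply D.good_s
    · apply ih
      intro k
      have := h k.succ
      simpa using this
    · left
      have := h ⟨0, by simp⟩
      simpa using this

/-- one weak step down -/
def Stp (pi : D.V) (a b : D.W) : Prop :=
  ∃ i, b = D.s i * a ∧ D.coroot (D.simple i) (D.act a pi) = -1

def Dn (pi : D.V) : D.W → D.W → Prop := Relation.ReflTransGen (D.Stp pi)

lemma stp_length {pi : D.V} (hpi : D.IsDominant pi) {a b : D.W} (h : D.Stp pi a b) :
    D.length b + 1 ≤ D.length a := by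
  obtain ⟨i, rfl, h⟩ := h
  apply D.length_srefl_lt (D.simple_pos i)
  intro hp
  have := D.dom_nonneg hpi hp
  rw [← coroot_act D (D.simple_mem i), h] at this
  linarith

lemma dn_good {pi : D.V} {a b : D.W} (ha : D.Good pi a) (h : D.Dn pi a b) : D.Good pi b := by
  induction h with
  | refl => exact ha
  | tail _ h ih =>
    obtain ⟨i, rfl, h⟩ := h
    exact D.good_s i ih (Or.inr h)

lemma dn_weak {pi : D.V} (hpi : D.IsDominant pi) {a b : D.W} (h : D.Dn pi a b) :
    D.weakLE b a := by
  unfold weakLE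
  induction h with
  | refl => simp [length_one]
  | @tail b c _ h ih =>
    have h1 := D.stp_length hpi h
    obtain ⟨i, rfl, h⟩ := h
    have h2 := D.length_mul_le (a * (D.s i * b)⁻¹) (D.s i * b)
    rw [inv_mul_cancel_right] at h2
    have h3 := D.length_mul_le (a * b⁻¹) (D.s i)
    have h4 := D.length_s_le i
    have e : a * (D.s i * b)⁻¹ = a * b⁻¹ * D.s i := by rw [mul_inv_rev, s_inv, mul_assoc]
    rw [← e] at h3
    omega

lemma act_s_of {pi : D.V} {a : D.W} {i : D.I} {c : ℚ}
    (h : D.coroot (D.simple i) (D.act a pi) = c) :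
    D.act (D.s i * a) pi = D.act a pi - c • D.simple i := by
  rw [act_mul]; unfold s; rw [D.srefl_apply _ (D.simple_mem i), h]

lemma exists_simple_pos {β : D.V} (hβ : D.IsPosRoot β) :
    ∃ i, 0 < D.coroot (D.simple i) β := by
  by_contra hn
  push Not at hn
  have h1 := D.B_pos hβ.1
  have h2 : D.B β β = ∑ i, D.crd i β * D.B β (D.simple i) := by
    rw [← B_sum_right, ← D.pos_eq hβ]
  rw [h2] at h1
  refine absurd h1 (not_lt.mpr (Finset.sum_nonpos fun i _ => ?_))
  have h3 := D.coroot_B (D.simple_mem i) β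
  have h4 := D.B_pos (D.simple_mem i)
  have h5 := mul_nonpos_of_nonpos_of_nonneg (hn i) h4.le
  exact mul_nonpos_of_nonneg_of_nonpos (D.pos_crd hβ i) (by linarith)

lemma pair_pos {β γ : D.V} (hβ : β ∈ D.roots) (hγ : γ ∈ D.roots) (h : 0 < D.coroot β γ) :
    0 < D.coroot γ β := by
  have h1 := D.coroot_B hβ γ
  have h2 := D.coroot_B hγ β
  have h3 := D.B_pos hβ
  have h4 := D.B_pos hγ
  rw [B_comm D β γ] at h2
  have := mul_pos h h3
  by_contra hn
  push Not at hn
  have := mul_nonpos_of_nonpos_of_nonneg hn h4.le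
  linarith

lemma reach {pi : D.V} (hpi : D.IsDominant pi) (N : ℕ) : ∀ β, D.IsPosRoot β →
    ∑ k, D.crd k β ≤ N → ∀ a, D.Good pi a → D.coroot β (D.act a pi) = -1 →
    ∃ b, D.Dn pi a b ∧ D.act b pi = D.act a pi + β := by
  induction N with
  | zero =>
    intro β hβ hN
    exfalso
    apply D.root_ne_zero hβ.1
    rw [D.pos_eq hβ]
    apply Finset.sum_eq_zero
    intro i _
    have h1 : ∑ k, D.crd k β = 0 :=
      le_antisymm (by simpa using hN) (Finset.sum_nonneg fun k _ => D.pos_crd hβ k)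
    rw [(Finset.sum_eq_zero_iff_of_nonneg fun k _ => D.pos_crd hβ k).mp h1 i (Finset.mem_univ i),
      zero_smul]
  | succ N ih =>
    intro β hβ hN a ha hm
    obtain ⟨i, hi⟩ := D.exists_simple_pos hβ
    by_cases hp : D.IsPosRoot (D.act (D.s i) β)
    · obtain ⟨n, hn⟩ := D.crystallographic _ (D.simple_mem i) _ hβ.1
      have hn1 : 1 ≤ n := by
        rw [hn] at hi
        have : 0 < n := by exact_mod_cast hi
        omega
      have eβ : D.act (D.s i) β = β - (n : ℚ) • D.simple i := by
        unfold s; rw [D.srefl_apply _ (D.simple_mem i), hn]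
      have hN' : ∑ k, D.crd k (D.act (D.s i) β) ≤ N := by
        have : ∑ k, D.crd k (D.act (D.s i) β) = ∑ k, D.crd k β - n := by
          rw [eβ]
          simp_rw [crd_sub, crd_smul, crd_simple]
          rw [Finset.sum_sub_distrib]; simp
        rw [this]
        have : (1 : ℚ) ≤ n := by exact_mod_cast hn1
        push_cast at hN
        linarith
      obtain ⟨A, hA⟩ := D.weight_int hpi (D.simple_mem i) a
      have hA1 : -1 ≤ A := by
        have := ha.2 _ (D.simple_pos i)
        rw [hA] at this
        exact_mod_cast this
      have hβ' : D.coroot (D.act (D.s i) β) (D.act a pi)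
          = -1 - A * D.coroot β (D.simple i) := by
        rw [← coroot_s D hβ.1, act_s_of D hA, map_sub, map_smul, hm, smul_eq_mul]
      have hA2 : A ≤ 0 := by
        have h1 := ha.2 _ hp
        rw [hβ'] at h1
        have h2 := D.pair_pos (D.simple_mem i) hβ.1 hi
        by_contra hc
        push Not at hc
        have : (0 : ℚ) < A := by exact_mod_cast hc
        have := mul_pos this h2
        linarith
      have hcase : A = 0 ∨ A = -1 := by omega
      rcases hcase with rfl | rfl
      · obtain ⟨b, hb, eb⟩ := ih _ hp hN' a ha (by rw [hβ']; simp)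
        have gb := D.dn_good ha hb
        have hpair : D.coroot (D.simple i) (D.act b pi) = -n := by
          rw [eb, eβ, map_add, map_sub, map_smul, hA, hn, D.coroot_self _ (D.simple_mem i)]
          simp; ring
        have h1 := gb.2 _ (D.simple_pos i)
        rw [hpair] at h1
        have : n = 1 := by
          have : n ≤ 1 := by exact_mod_cast (by linarith : (n : ℚ) ≤ 1)
          omega
        subst this
        have hpair' : D.coroot (D.simple i) (D.act b pi) = -1 := by rw [hpair]; simp
        refine ⟨D.s i * b, hb.tail ⟨i, rfl, hpair'⟩, ?_⟩
        rw [act_s_of D hpair', eb, eβ]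
        push_cast
        module
      · have hA' : D.coroot (D.simple i) (D.act a pi) = -1 := by rw [hA]; simp
        have ga := D.good_s i ha (Or.inr hA')
        have hs : D.Dn pi a (D.s i * a) := Relation.ReflTransGen.single ⟨i, rfl, hA'⟩
        have hpr : D.coroot (D.act (D.s i) β) (D.act (D.s i * a) pi) = -1 := by
          rw [act_mul, D.coroot_equivariant _ _ hβ.1, hm]
        obtain ⟨b, hb, eb⟩ := ih _ hp hN' _ ga hpr
        have gb := D.dn_good ga hb
        rw [act_s_of D hA', eβ] at eb
        have hpair : D.coroot (D.simple i) (D.act b pi) = 1 - n := by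
          rw [eb, map_add, map_sub, map_sub, map_smul, map_smul, hA', hn,
            D.coroot_self _ (D.simple_mem i)]
          simp; ring
        have h1 := gb.2 _ (D.simple_pos i)
        rw [hpair] at h1
        have hn2 : n = 1 ∨ n = 2 := by
          have : n ≤ 2 := by exact_mod_cast (by linarith : (n : ℚ) ≤ 2)
          omega
        rcases hn2 with rfl | rfl
        · refine ⟨b, hs.trans hb, ?_⟩
          rw [eb]; simp
        · have hpair' : D.coroot (D.simple i) (D.act b pi) = -1 := by rw [hpair]; norm_num
          refine ⟨D.s i * b, (hs.trans hb).tail ⟨i, rfl, hpair'⟩, ?_⟩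
          rw [act_s_of D hpair', eb]
          push_cast
          module
    · obtain ⟨c, hc, e⟩ := D.simple_perm hβ i hp
      have h1 := D.coroot_smul hβ.1 (D.simple_mem i) e (D.act a pi)
      rw [hm] at h1
      have h2 := ha.2 _ (D.simple_pos i)
      obtain ⟨n, hn⟩ := D.pos_nat hβ i
      rw [e, crd_smul, crd_simple, if_pos rfl, mul_one] at hn
      have hc1 : c = 1 := by
        rw [hn] at hc h1 ⊢
        have h3 : 0 < n := by exact_mod_cast hc
        have h4 : n ≤ 1 := by exact_mod_cast (by linarith : (n : ℚ) ≤ 1)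
        have : n = 1 := by omega
        rw [this]; simp
      subst hc1
      have h3 : D.coroot (D.simple i) (D.act a pi) = -1 := by linarith
      refine ⟨D.s i * a, Relation.ReflTransGen.single ⟨i, rfl, h3⟩, ?_⟩
      rw [act_s_of D h3, e]; simp

lemma reach' {pi : D.V} (hpi : D.IsDominant pi) {β : D.V} (hβ : D.IsPosRoot β) {a : D.W}
    (ha : D.Good pi a) (h : D.coroot β (D.act a pi) = -1) :
    ∃ b, D.Dn pi a b ∧ D.act b pi = D.act a pi + β := by
  obtain ⟨N, hN⟩ := exists_nat_ge (∑ k, D.crd k β)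
  exact D.reach hpi N β hβ hN a ha h

lemma bruhat_reach {pi : D.V} (hpi : D.IsDominant pi) {z w : D.W} (hw : D.Good pi w)
    (h : D.bruhatLE z w) : ∃ a, D.Dn pi w a ∧ D.act a pi = D.act z pi := by
  unfold bruhatLE at h
  induction h using Relation.ReflTransGen.head_induction_on with
  | refl => exact ⟨w, Relation.ReflTransGen.refl, rfl⟩
  | @head x y hxy _ ih =>
    obtain ⟨a, ha, ea⟩ := ih
    have ga := D.dn_good hw ha
    obtain ⟨⟨β, hβ, rfl⟩, hlen⟩ := hxy
    have hp : D.IsPosRoot (D.act x⁻¹ β) := by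
      by_contra hn
      have := D.length_srefl_lt hβ x hn
      omega
    have h1 := D.dom_nonneg hpi hp
    rw [← coroot_act D hβ.1] at h1
    have e2 : D.coroot β (D.act (D.srefl β * x) pi) = - D.coroot β (D.act x pi) := by
      rw [act_mul, coroot_act D hβ.1, srefl_inv D hβ.1, srefl_self D hβ.1, coroot_neg D hβ.1]
    have e3 : D.act x pi = D.act (D.srefl β * x) pi
        - D.coroot β (D.act (D.srefl β * x) pi) • β := by
      rw [e2, act_mul, D.srefl_apply β hβ.1]; simp
    rw [← ea] at e2 e3
    have h2 := ga.2 β hβ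
    obtain ⟨n, hn⟩ := D.weight_int hpi hβ.1 a
    have hc : n = 0 ∨ n = -1 := by
      have a1 : -1 ≤ n := by rw [hn] at h2; exact_mod_cast h2
      have a2 : n ≤ 0 := by exact_mod_cast (by linarith : (n : ℚ) ≤ 0)
      omega
    rcases hc with rfl | rfl
    · refine ⟨a, ha, ?_⟩
      rw [e3, hn]; simp
    · obtain ⟨b, hb, eb⟩ := D.reach' hpi hβ ga (by rw [hn]; simp)
      refine ⟨b, ha.trans hb, ?_⟩
      rw [e3, hn, eb]; simp

lemma bruhat_dn {pi : D.V} (hpi : D.IsDominant pi) {z w : D.W} (hw : D.Good pi w)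
    (hz : D.IsMinRep (D.stab pi) z) (h : D.bruhatLE z w) : D.Dn pi w z := by
  obtain ⟨a, ha, ea⟩ := D.bruhat_reach hpi hw h
  have := D.cond_unique hpi (D.dn_good hw ha).1 (D.cond_of_minRep hz) ea
  rwa [this] at ha

/-- weak intervals: path and weight difference along any additive word -/
lemma word_dn {pi : D.V} (hpi : D.IsDominant pi) (l : List D.I) (z : D.W) :
    ∀ w, D.Good pi w → D.wordProd l * z = w → l.length + D.length z = D.length w →
    D.Dn pi w z ∧ D.act z pi - D.act w pi = (l.map D.simple).sum := by
  induction l with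
  | nil =>
    intro w _ h _
    rw [wordProd_nil, one_mul] at h
    subst h
    exact ⟨Relation.ReflTransGen.refl, by simp⟩
  | cons i l ih =>
    intro w hw h hl
    rw [wordProd_cons, mul_assoc] at h
    have hs : D.s i * w = D.wordProd l * z := by rw [← h, s_mul_s_mul]
    have h1 := D.length_mul_le (D.wordProd l) z
    have h2 := D.length_le l
    have h3 : D.length w ≤ D.length (D.s i * w) + 1 := by
      have := D.length_mul_le (D.s i) (D.s i * w)
      rw [s_mul_s_mul] at this
      have := D.length_s_le i
      omega
    rw [← hs] at h1
    rw [List.length_cons] at hl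
    have hneg : ¬ D.IsPosRoot (D.act w⁻¹ (D.simple i)) := by
      intro hp
      have : D.length w < D.length (D.s i * w) := D.length_srefl_gt (D.simple_pos i) w hp
      omega
    have hr := D.roots_invariant w⁻¹ _ (D.simple_mem i)
    have hpos := (D.pos_or_neg hr).resolve_left hneg
    have d1 := D.dom_nonneg hpi hpos
    rw [coroot_neg D hr, ← coroot_act D (D.simple_mem i)] at d1
    have d2 := hw.2 _ (D.simple_pos i)
    obtain ⟨n, hn⟩ := D.weight_int hpi (D.simple_mem i) w
    have hn0 : n ≠ 0 := by
      rintro rfl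
      have := hw.1 _ hpos (by rw [coroot_neg D hr, ← coroot_act D (D.simple_mem i), hn]; simp)
      rw [map_neg, act_act_inv] at this
      exact D.not_pos_neg (D.simple_pos i) this
    have hn1 : n = -1 := by
      rw [hn] at d1 d2
      have a1 : -1 ≤ n := by exact_mod_cast d2
      have a2 : n ≤ 0 := by exact_mod_cast (by linarith : (n : ℚ) ≤ 0)
      omega
    subst hn1
    have hpair : D.coroot (D.simple i) (D.act w pi) = -1 := by rw [hn]; simp
    obtain ⟨p1, p2⟩ := ih (D.s i * w) (D.good_s i hw (Or.inr hpair)) hs.symm (by omega)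
    refine ⟨Relation.ReflTransGen.head ⟨i, rfl, hpair⟩ p1, ?_⟩
    rw [act_s_of D hpair] at p2
    rw [List.map_cons, List.sum_cons, ← p2]
    module

lemma weak_dn {pi : D.V} (hpi : D.IsDominant pi) {z w : D.W} (hw : D.Good pi w)
    (h : D.weakLE z w) : D.Dn pi w z := by
  obtain ⟨l, h1, h2⟩ := D.exists_reduced (w * z⁻¹)
  unfold weakLE at h
  exact (D.word_dn hpi l z w hw (by rw [h1]; simp) (by omega)).1

lemma weak_bruhat {z w : D.W} (h : D.weakLE z w) : D.bruhatLE z w := by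
  obtain ⟨l, h1, h2⟩ := D.exists_reduced (w * z⁻¹)
  unfold weakLE at h
  rw [← h2] at h
  have h3 : D.wordProd l * z = w := by rw [h1]; simp
  clear h1 h2
  induction l generalizing w with
  | nil =>
    rw [wordProd_nil, one_mul] at h3
    subst h3
    exact Relation.ReflTransGen.refl
  | cons i l ih =>
    rw [wordProd_cons, mul_assoc] at h3
    have a1 := D.length_mul_le (D.wordProd l) z
    have a2 := D.length_le l
    have a3 := D.length_mul_le (D.s i) (D.wordProd l * z)
    rw [h3] at a3
    have a4 := D.length_s_le i
    rw [List.length_cons] at h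
    refine Relation.ReflTransGen.tail (ih (w := D.wordProd l * z) (by omega) rfl) ?_
    exact ⟨⟨D.simple i, D.simple_pos i, h3.symm⟩, by omega⟩

/-- the main equivalence for good elements -/
lemma interval_iff {pi : D.V} (hpi : D.IsDominant pi) {w : D.W} (hw : D.Good pi w) (z : D.W) :
    (D.IsMinRep (D.stab pi) z ∧ D.bruhatLE z w) ↔ D.weakLE z w := by
  constructor
  · rintro ⟨h1, h2⟩
    exact D.dn_weak hpi (D.bruhat_dn hpi hw h1 h2)
  · intro h
    exact ⟨D.minRep_of_cond hpi (D.dn_good hw (D.weak_dn hpi hw h)).1, D.weak_bruhat h⟩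

lemma weak_one (w : D.W) : D.weakLE 1 w := by simp [weakLE, length_one]

lemma weight_diff {pi pi' : D.V} (hpi : D.IsDominant pi) (hpi' : D.IsDominant pi')
    {z w x u : D.W} (hw : D.Good pi w) (hu : D.Good pi' u) (h1 : D.weakLE z w)
    (h2 : D.weakLE x u) (e : w * z⁻¹ = u * x⁻¹) :
    D.act x pi' - D.act u pi' = D.act z pi - D.act w pi := by
  obtain ⟨l, e1, e2⟩ := D.exists_reduced (w * z⁻¹)
  unfold weakLE at h1 h2
  rw [(D.word_dn hpi l z w hw (by rw [e1]; simp) (by omega)).2,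
    (D.word_dn hpi' l x u hu (by rw [e1, e]; simp) (by rw [← e] at h2; omega)).2]

lemma edge_root {pi : D.V} (hpi : D.IsDominant pi) {z z' : D.W} (hz' : D.Good pi z')
    (h : D.weakLE z z') (hne : z ≠ z') {γ : D.V} (hγ : D.IsPosRoot γ)
    (hs : D.SameCoset (D.stab pi) (z * D.srefl γ) z') :
    D.coroot γ pi = 1 ∧ ∃ β, D.IsPosRoot β ∧ D.act z pi = D.act z' pi + β := by
  have e := D.act_eq_of_sameCoset hs
  have hr := D.roots_invariant z γ hγ.1
  have e1 : D.act z' pi = D.act z pi - D.coroot γ pi • D.act z γ := by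
    rw [← e, act_mul, D.srefl_apply γ hγ.1, map_sub, map_smul]
  have c1 : D.coroot (D.act z γ) (D.act z' pi) = - D.coroot γ pi := by
    rw [← e, act_mul, D.coroot_equivariant _ _ hγ.1, coroot_act D hγ.1, srefl_inv D hγ.1,
      srefl_self D hγ.1, coroot_neg D hγ.1]
  have hne0 : D.coroot γ pi ≠ 0 := by
    intro h0
    rw [h0, zero_smul, sub_zero] at e1
    exact hne (D.cond_unique hpi (D.dn_good hz' (D.weak_dn hpi hz' h)).1 hz'.1 e1.symm)
  have hge := D.dom_nonneg hpi hγ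
  have hgt : 0 < D.coroot γ pi := lt_of_le_of_ne hge (Ne.symm hne0)
  have hpos : D.IsPosRoot (D.act z γ) := by
    by_contra hn
    have hp := (D.pos_or_neg hr).resolve_left hn
    obtain ⟨l, e2, e3⟩ := D.exists_reduced (z' * z⁻¹)
    unfold weakLE at h
    have h4 := (D.word_dn hpi l z z' hz' (by rw [e2]; simp) (by omega)).2
    have hl : ∀ (l : List D.I) k, 0 ≤ D.crd k (l.map D.simple).sum := by
      intro l k
      induction l with
      | nil => simp [crd]
      | cons i l ih =>
        rw [List.map_cons, List.sum_cons, crd_add, crd_simple]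
        split_ifs <;> linarith
    apply D.root_ne_zero hp.1
    rw [D.pos_eq hp]
    apply Finset.sum_eq_zero
    intro k _
    have a1 := D.pos_crd hp k
    have a2 := hl l k
    have e5 : (l.map D.simple).sum = D.coroot γ pi • D.act z γ := by
      rw [← h4, e1]; simp
    rw [e5, crd_smul] at a2
    rw [crd_neg] at a1
    have : D.crd k (D.act z γ) = 0 := by
      by_contra hk
      have : D.crd k (D.act z γ) < 0 := lt_of_le_of_ne (by linarith) hk
      have := mul_neg_of_pos_of_neg hgt this
      linarith
    rw [crd_neg, this]; simp
  have hm := hz'.2 _ hpos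
  rw [c1] at hm
  obtain ⟨n, hn⟩ := hpi.1 γ hγ
  have h1 : D.coroot γ pi = 1 := by
    rw [hn] at hgt hm ⊢
    have a1 : 0 < n := by exact_mod_cast hgt
    have a2 : n ≤ 1 := by exact_mod_cast (by linarith : (n : ℚ) ≤ 1)
    have : n = 1 := by omega
    rw [this]; simp
  refine ⟨h1, D.act z γ, hpos, ?_⟩
  rw [e1, h1]; simp

lemma edge_of_diff {pi : D.V} {x x' : D.W} {β : D.V}
    (hβ : D.IsPosRoot β) (h : D.act x pi = D.act x' pi + β) :
    ∃ γ, D.IsPosRoot γ ∧ D.SameCoset (D.stab pi) (x * D.srefl γ) x' := by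
  have hB : D.B (D.act x pi) (D.act x pi) = D.B (D.act x' pi) (D.act x' pi) := by
    rw [B_act, B_act]
  rw [h, B_add_right, B_add_left, B_add_left, B_comm D β] at hB
  have hp := D.B_pos hβ.1
  have hc := D.coroot_B hβ.1 (D.act x' pi)
  have h1 : D.coroot β (D.act x' pi) = -1 := by
    have : (D.coroot β (D.act x' pi) + 1) * D.B β β = 0 := by linear_combination hc + hB
    have := (mul_eq_zero.mp this).resolve_right hp.ne'
    linarith
  have hx : D.coroot β (D.act x pi) = 1 := by
    rw [h, map_add, h1, D.coroot_self β hβ.1]; norm_num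
  have hr := D.roots_invariant x⁻¹ β hβ.1
  have key : D.SameCoset (D.stab pi) (x * D.srefl (D.act x⁻¹ β)) x' := by
    apply D.sameCoset_of_act_eq
    rw [srefl_conj D hβ.1, inv_inv]
    have : x * (x⁻¹ * D.srefl β * x) = D.srefl β * x := by group
    rw [this, act_mul, D.srefl_apply β hβ.1, hx, h]; simp
  rcases D.pos_or_neg hr with hp | hp
  · exact ⟨_, hp, key⟩
  · exact ⟨_, hp, by rw [srefl_neg D hr]; exact key⟩

end Proof

end WeylSetting

/-- For a simply-laced Weyl group and `π`-minuscule `v ≤ w` in `W^P` with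
`w v⁻¹` `π'`-minuscule for a dominant `π'`, `z ↦ z v⁻¹` is an isomorphism from
the `Λ ≡ π` Bruhat graph on `[v,w]^P` to the `Λ' ≡ π'` Bruhat graph on
`[id, w v⁻¹]^{P'}`: it carries the interval onto the interval, is a poset
isomorphism matching edges, satisfies `W_{π'}(z v⁻¹) = W_π(z)`, and all edge
multiplicities equal `1` on both sides. -/
theorem lambda_bruhat_graph_isomorphism
    (D : WeylSetting) (hsl : D.SimplyLaced)
    (pi : D.V) (hpi : D.IsDominant pi)
    (v w : D.W) (hv : D.IsMinuscule pi v) (hw : D.IsMinuscule pi w)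
    (hvr : D.IsMinRep (D.stab pi) v) (hwr : D.IsMinRep (D.stab pi) w)
    (hvw : D.bruhatLE v w)
    (pi' : D.V) (hpi' : D.IsDominant pi') (hmin : D.IsMinuscule pi' (w * v⁻¹)) :
    (∀ z : D.W,
      (D.IsMinRep (D.stab pi) z ∧ D.bruhatLE v z ∧ D.bruhatLE z w) ↔
        (D.IsMinRep (D.stab pi') (z * v⁻¹) ∧ D.bruhatLE 1 (z * v⁻¹) ∧
          D.bruhatLE (z * v⁻¹) (w * v⁻¹))) ∧
    (∀ z z' : D.W,
      (D.IsMinRep (D.stab pi) z ∧ D.bruhatLE v z ∧ D.bruhatLE z w) →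
      (D.IsMinRep (D.stab pi) z' ∧ D.bruhatLE v z' ∧ D.bruhatLE z' w) →
        ((D.bruhatLE z z' ↔ D.bruhatLE (z * v⁻¹) (z' * v⁻¹)) ∧
         (D.GEdge (D.stab pi) z z' ↔
            D.GEdge (D.stab pi') (z * v⁻¹) (z' * v⁻¹)))) ∧
    (∀ z : D.W, D.IsMinRep (D.stab pi) z → D.bruhatLE v z → D.bruhatLE z w →
      D.act (z * v⁻¹) pi' - D.act (w * v⁻¹) pi' = D.act z pi - D.act w pi) ∧
    (∀ z z' : D.W, ∀ γ : D.V,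
      (D.IsMinRep (D.stab pi) z ∧ D.bruhatLE v z ∧ D.bruhatLE z w) →
      (D.IsMinRep (D.stab pi) z' ∧ D.bruhatLE v z' ∧ D.bruhatLE z' w) →
      D.IsPosRoot γ → D.bruhatLT z z' →
        ((D.SameCoset (D.stab pi) (z * D.srefl γ) z' → D.coroot γ pi = 1) ∧
         (D.SameCoset (D.stab pi') ((z * v⁻¹) * D.srefl γ) (z' * v⁻¹) →
            D.coroot γ pi' = 1))) := by
  clear hsl hvr hwr
  have gv := D.good_of_minuscule hpi hv
  have gw := D.good_of_minuscule hpi hw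
  have gu := D.good_of_minuscule hpi' hmin
  have wvw : D.weakLE v w :=
    (D.interval_iff hpi gw v).mp ⟨D.minRep_of_cond hpi gv.1, hvw⟩
  -- the interval in terms of weak order
  have hA : ∀ z, (D.IsMinRep (D.stab pi) z ∧ D.bruhatLE v z ∧ D.bruhatLE z w) ↔
      (D.weakLE v z ∧ D.weakLE z w) := by
    intro z
    constructor
    · rintro ⟨h1, h2, h3⟩
      have h4 := (D.interval_iff hpi gw z).mp ⟨h1, h3⟩
      have gz := D.dn_good gw (D.weak_dn hpi gw h4)
      exact ⟨(D.interval_iff hpi gz v).mp ⟨D.minRep_of_cond hpi gv.1, h2⟩, h4⟩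
    · rintro ⟨h1, h2⟩
      have h3 := (D.interval_iff hpi gw z).mpr h2
      exact ⟨h3.1, D.weak_bruhat h1, h3.2⟩
  have hB : ∀ z, (D.IsMinRep (D.stab pi') (z * v⁻¹) ∧ D.bruhatLE 1 (z * v⁻¹) ∧
      D.bruhatLE (z * v⁻¹) (w * v⁻¹)) ↔ D.weakLE (z * v⁻¹) (w * v⁻¹) := by
    intro z
    rw [← D.interval_iff hpi' gu]
    have := D.weak_bruhat (D.weak_one (z * v⁻¹))
    tauto
  have hq : ∀ z z' : D.W, z' * v⁻¹ * (z * v⁻¹)⁻¹ = z' * z⁻¹ := by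
    intro z z'; group
  have hC : ∀ z, (D.weakLE v z ∧ D.weakLE z w) ↔ D.weakLE (z * v⁻¹) (w * v⁻¹) := by
    intro z
    unfold WeylSetting.weakLE at wvw ⊢
    rw [hq]
    have h1 := D.length_mul_le (w * z⁻¹) z
    have h2 := D.length_mul_le (z * v⁻¹) v
    rw [inv_mul_cancel_right] at h1 h2
    have h3 := D.length_mul_le (w * z⁻¹) (z * v⁻¹)
    have e : w * z⁻¹ * (z * v⁻¹) = w * v⁻¹ := by group
    rw [e] at h3
    omega
  have hD : ∀ z z', D.weakLE v z → D.weakLE v z' →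
      (D.weakLE z z' ↔ D.weakLE (z * v⁻¹) (z' * v⁻¹)) := by
    intro z z' h1 h2
    unfold WeylSetting.weakLE at h1 h2 ⊢
    rw [hq]
    omega
  have gz : ∀ z, D.weakLE z w → D.Good pi z := fun z h => D.dn_good gw (D.weak_dn hpi gw h)
  have gz' : ∀ z, D.weakLE (z * v⁻¹) (w * v⁻¹) → D.Good pi' (z * v⁻¹) :=
    fun z h => D.dn_good gu (D.weak_dn hpi' gu h)
  have hW : ∀ z, D.weakLE v z → D.weakLE z w →
      D.act (z * v⁻¹) pi' - D.act (w * v⁻¹) pi' = D.act z pi - D.act w pi := by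
    intro z h1 h2
    exact D.weight_diff hpi hpi' gw gu h2 ((hC z).mp ⟨h1, h2⟩) (hq z w).symm
  have hO : ∀ z z', (D.weakLE v z ∧ D.weakLE z w) → (D.weakLE v z' ∧ D.weakLE z' w) →
      ((D.bruhatLE z z' ↔ D.weakLE z z') ∧
        (D.bruhatLE (z * v⁻¹) (z' * v⁻¹) ↔ D.weakLE z z')) := by
    intro z z' hz hz'
    constructor
    · exact ⟨fun h => (D.interval_iff hpi (gz _ hz'.2) z).mp
        ⟨D.minRep_of_cond hpi (gz _ hz.2).1, h⟩, D.weak_bruhat⟩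
    · rw [hD z z' hz.1 hz'.1]
      exact ⟨fun h => (D.interval_iff hpi' (gz' _ ((hC z').mp hz')) _).mp
        ⟨D.minRep_of_cond hpi' (gz' _ ((hC z).mp hz)).1, h⟩, D.weak_bruhat⟩
  refine ⟨fun z => by rw [hA, hB, hC], ?_, ?_, ?_⟩
  · intro z z' hz hz'
    rw [hA] at hz hz'
    obtain ⟨o1, o2⟩ := hO z z' hz hz'
    refine ⟨o1.trans o2.symm, ?_⟩
    have d1 := hW z hz.1 hz.2
    have d2 := hW z' hz'.1 hz'.2
    have g1 := gz z hz.2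
    have g2 := gz z' hz'.2
    have g1' := gz' z ((hC z).mp hz)
    have g2' := gz' z' ((hC z').mp hz')
    have dd : D.act (z * v⁻¹) pi' - D.act (z' * v⁻¹) pi' = D.act z pi - D.act z' pi := by
      have := congrArg₂ (· - ·) d1 d2
      simpa using this
    constructor
    · rintro ⟨_, _, ⟨hle, hne⟩, γ, hγ, hs⟩
      obtain ⟨_, β, hβ, e⟩ := D.edge_root hpi g2 (o1.mp hle) hne hγ hs
      refine ⟨D.minRep_of_cond hpi' g1'.1, D.minRep_of_cond hpi' g2'.1,
        ⟨o2.mpr (o1.mp hle), fun h => hne (mul_right_cancel h)⟩, ?_⟩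
      apply D.edge_of_diff hβ
      rw [e] at dd
      rw [add_sub_cancel_left] at dd
      rw [← dd]; abel
    · rintro ⟨_, _, ⟨hle, hne⟩, γ, hγ, hs⟩
      obtain ⟨_, β, hβ, e⟩ := D.edge_root hpi' g2'
        ((hD z z' hz.1 hz'.1).mp (o2.mp hle)) hne hγ hs
      refine ⟨D.minRep_of_cond hpi g1.1, D.minRep_of_cond hpi g2.1,
        ⟨o1.mpr (o2.mp hle), fun h => hne (by rw [h])⟩, ?_⟩
      apply D.edge_of_diff hβ
      rw [e] at dd
      rw [add_sub_cancel_left] at dd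
      rw [dd]; abel
  · intro z h1 h2 h3
    obtain ⟨a, b⟩ := (hA z).mp ⟨h1, h2, h3⟩
    exact hW z a b
  · intro z z' γ hz hz' hγ hlt
    rw [hA] at hz hz'
    obtain ⟨o1, o2⟩ := hO z z' hz hz'
    have hwk := o1.mp hlt.1
    refine ⟨fun hs => (D.edge_root hpi (gz _ hz'.2) hwk hlt.2 hγ hs).1, fun hs => ?_⟩
    exact (D.edge_root hpi' (gz' _ ((hC z').mp hz')) ((hD z z' hz.1 hz'.1).mp hwk)
      (fun h => hlt.2 (mul_right_cancel h)) hγ hs).1
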